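/- Let n ≥ 2 be an integer, let V be a finite set of n agents, let C : V → ℤ be a configuration, and define the potential Φ(C) = Σ_{w ∈ V} 6^{−C(w)}. Draw an ordered pair (u, v) uniformly at random from {(u, v) ∈ V × V : u ≠ v} and let the random configuration C′ be given by C′(u) = min{C(u), C(v)} + 1 and C′(w) = C(w) for every w ≠ u. Then E[Φ(C′)] ≤ (1 − 1/(3n))·Φ(C). -/

import Mathlib

/-- Let `V` be a finite set of `n ≥ 2` agents, `C : V → ℤ` a
configuration and `Φ(C) = Σ_w 6^{−C(w)}`. Draw an ordered pair `(u, v)` uniformly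
from the pairs of distinct agents and let `C′(u) = min{C(u), C(v)} + 1`,
`C′(w) = C(w)` otherwise. Then `E[Φ(C′)] ≤ (1 − 1/(3n))·Φ(C)` (the expectation
with respect to the uniform measure being the average over all such pairs). -/
theorem stmt_10 (n : ℕ) (hn : 2 ≤ n) (V : Type) [Fintype V] [DecidableEq V]
    (hV : Fintype.card V = n) (C : V → ℤ) :
    (∑ p ∈ Finset.univ.filter fun p : V × V => p.1 ≠ p.2,
        ∑ w : V, (6 : ℝ) ^ (-(Function.update C p.1 (min (C p.1) (C p.2) + 1) w)))
        / ((Finset.univ.filter fun p : V × V => p.1 ≠ p.2).card : ℝ) ≤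
      (1 - 1 / (3 * (n : ℝ))) * ∑ w : V, (6 : ℝ) ^ (-C w) := by
  have H : ∀ f : V × V → ℝ, ∑ p ∈ Finset.univ.filter (fun p : V × V => p.1 ≠ p.2), f p
      = (∑ u : V, ∑ v : V, f (u, v)) - ∑ u : V, f (u, u) := by
    intro f
    rw [Finset.sum_filter, Fintype.sum_prod_type, ← Finset.sum_sub_distrib]
    refine Finset.sum_congr rfl fun u _ => ?_
    have h : ∀ v : V, (if u ≠ v then f (u, v) else 0)
        = f (u, v) - (if u = v then f (u, v) else 0) := by
      intro v
      by_cases h : u = v <;> simp [h]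
    simp only [h, Finset.sum_sub_distrib, Finset.sum_ite_eq, Finset.mem_univ, if_true]
  have hcard : ((Finset.univ.filter fun p : V × V => p.1 ≠ p.2).card : ℝ) = n * n - n := by
    have := H (fun _ => 1)
    simpa [hV] using this
  have hn' : (2 : ℝ) ≤ n := by exact_mod_cast hn
  set S := ∑ w : V, (6 : ℝ) ^ (-C w) with hS
  have hS0 : 0 ≤ S := Finset.sum_nonneg fun w _ => by positivity
  have hb : ∀ p : V × V,
      ∑ w : V, (6 : ℝ) ^ (-(Function.update C p.1 (min (C p.1) (C p.2) + 1) w))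
      ≤ S + ((6 : ℝ) ^ (-C p.2) - 5 * (6 : ℝ) ^ (-C p.1)) / 6 := by
    intro p
    have h1 : (6 : ℝ) ^ (-(min (C p.1) (C p.2) + 1))
        ≤ ((6 : ℝ) ^ (-C p.1) + (6 : ℝ) ^ (-C p.2)) / 6 := by
      have e : ∀ z : ℤ, (6 : ℝ) ^ (-(z + 1)) = (6 : ℝ) ^ (-z) / 6 := by
        intro z
        rw [neg_add, zpow_add₀ (by norm_num), zpow_neg_one, div_eq_mul_inv]
      rw [e]
      have p1 : (0 : ℝ) < (6 : ℝ) ^ (-C p.1) := by positivity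
      have p2 : (0 : ℝ) < (6 : ℝ) ^ (-C p.2) := by positivity
      rcases min_choice (C p.1) (C p.2) with h | h <;> rw [h] <;> linarith
    rw [hS, ← Finset.add_sum_erase _ _ (Finset.mem_univ p.1),
      ← Finset.add_sum_erase _ (fun w => (6 : ℝ) ^ (-C w)) (Finset.mem_univ p.1)]
    have h2 : ∑ w ∈ Finset.univ.erase p.1,
        (6 : ℝ) ^ (-(Function.update C p.1 (min (C p.1) (C p.2) + 1) w))
        = ∑ w ∈ Finset.univ.erase p.1, (6 : ℝ) ^ (-C w) := by
      refine Finset.sum_congr rfl fun w hw => ?_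
      rw [Function.update_of_ne (Finset.ne_of_mem_erase hw)]
    rw [h2, Function.update_self]
    linarith
  have htot := Finset.sum_le_sum
    (fun p (_ : p ∈ Finset.univ.filter (fun p : V × V => p.1 ≠ p.2)) => hb p)
  rw [H (fun p => S + ((6 : ℝ) ^ (-C p.2) - 5 * (6 : ℝ) ^ (-C p.1)) / 6)] at htot
  simp only [Finset.sum_add_distrib, ← Finset.sum_div, Finset.sum_sub_distrib,
    ← Finset.mul_sum, Finset.sum_const, Finset.card_univ, hV, nsmul_eq_mul, ← hS] at htot
  have hpos : (0 : ℝ) < n * n - n := by nlinarith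
  rw [hcard, div_le_iff₀ hpos]
  refine htot.trans ?_
  have e : (1 - 1 / (3 * (n : ℝ))) * S * (n * n - n) = (n * n - n) * S - (n - 1) / 3 * S := by
    field_simp
  rw [e]
  nlinarith [mul_nonneg (sub_nonneg.2 hn') hS0]
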